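/- Let m, n ∈ ℕ and, for each component index p ∈ {1,2}, let μ_{p1},…,μ_{pm} > 0, ν_{p1},…,ν_{pn} > 0, M_{p1},…,M_{pm} > 0, N_{p1},…,N_{pn} > 0 be real numbers, and set Υ_p = Σ_{j=1}^n N_{pj} − Σ_{i=1}^m M_{pi}. In the bicomplex numbers represented in idempotent coordinates as the product ring ℂ × ℂ, define the coefficients a_k = (a_{1k}, a_{2k}) with a_{pk} = (∏_{i=1}^m Γ(μ_{pi} + k·M_{pi})) / ((∏_{j=1}^n Γ(ν_{pj} + k·N_{pj})) · k!). If Υ_1 > −1 and Υ_2 > −1, then for every Z = (z_1, z_2) ∈ ℂ × ℂ the bicomplex Fox–Wright series Σ_{k=0}^∞ a_k Z^k converges absolutely in each component, i.e. both families (a_{1k} z_1^k)_k and (a_{2k} z_2^k)_k are summable. -/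

import Mathlib

open scoped BigOperators

open Filter Topology

/-- Consecutive difference quotients of `log Γ`, bounded above by convexity. -/
lemma log_Gamma_add_sub_le {x h : ℝ} (hx : 0 < x) (hh : 0 < h) :
    Real.log (Real.Gamma (x + h)) - Real.log (Real.Gamma x) ≤ h * Real.log (x + h) := by
  have hxh : 0 < x + h := by linarith
  have key := Real.convexOn_log_Gamma.slope_mono_adjacent (x := x) (y := x + h) (z := x + h + 1)
    hx (Set.mem_Ioi.2 (by linarith)) (by linarith) (by linarith)
  simp only [Function.comp_apply, Real.Gamma_add_one hxh.ne',
    Real.log_mul hxh.ne' (Real.Gamma_pos_of_pos hxh).ne', add_sub_cancel_left, div_one,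
    add_sub_cancel_right] at key
  rw [div_le_iff₀ hh] at key
  linarith

/-- Consecutive difference quotients of `log Γ`, bounded below by convexity. -/
lemma le_log_Gamma_add_sub {x h : ℝ} (hx : 1 < x) (hh : 0 < h) :
    h * Real.log (x - 1) ≤ Real.log (Real.Gamma (x + h)) - Real.log (Real.Gamma x) := by
  have hx1 : 0 < x - 1 := by linarith
  have key := Real.convexOn_log_Gamma.slope_mono_adjacent (x := x - 1) (y := x) (z := x + h)
    hx1 (Set.mem_Ioi.2 (by linarith)) (by linarith) (by linarith)
  have hG := Real.Gamma_add_one hx1.ne'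
  rw [sub_add_cancel] at hG
  have hlog : Real.log (Real.Gamma x) - Real.log (Real.Gamma (x - 1)) = Real.log (x - 1) := by
    rw [hG, Real.log_mul hx1.ne' (Real.Gamma_pos_of_pos hx1).ne']
    ring
  simp only [Function.comp_apply, hlog, sub_sub_cancel, div_one, add_sub_cancel_left] at key
  rw [le_div_iff₀ hh] at key
  linarith

lemma tendsto_log_add_mul_sub_log (c : ℝ) {h : ℝ} (hh : 0 < h) :
    Tendsto (fun k : ℕ => Real.log (c + k * h) - Real.log k) atTop (𝓝 (Real.log h)) := by
  have hlim : Tendsto (fun k : ℕ => c / (k : ℝ) + h) atTop (𝓝 h) := by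
    simpa using (tendsto_const_div_atTop_nhds_zero_nat c).add_const h
  refine (hlim.log hh.ne').congr' ?_
  filter_upwards [eventually_gt_atTop 0, hlim.eventually (lt_mem_nhds hh)] with k hk hpos
  have hk' : (k : ℝ) ≠ 0 := by positivity
  have hmul : c + k * h = (c / k + h) * k := by field_simp
  rw [hmul, Real.log_mul hpos.ne' hk']
  ring

lemma tendsto_log_Gamma_increment {c h : ℝ} (hc : 0 < c) (hh : 0 < h) :
    Tendsto (fun k : ℕ => Real.log (Real.Gamma (c + ((k + 1 : ℕ) : ℝ) * h)) -
      Real.log (Real.Gamma (c + k * h)) - h * Real.log k) atTop (𝓝 (h * Real.log h)) := by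
  refine tendsto_of_tendsto_of_tendsto_of_le_of_le'
    ((tendsto_log_add_mul_sub_log (c - 1) hh).const_mul h)
    ((tendsto_log_add_mul_sub_log (c + h) hh).const_mul h) ?_ ?_
  · have hlarge : ∀ᶠ k : ℕ in atTop, 1 < (k : ℝ) * h :=
      (tendsto_natCast_atTop_atTop.atTop_mul_const hh).eventually_gt_atTop 1
    filter_upwards [hlarge] with k hk
    have key := le_log_Gamma_add_sub (x := c + k * h) (by linarith) hh
    rw [show c + ((k + 1 : ℕ) : ℝ) * h = c + k * h + h by push_cast; ring,
      show c - 1 + k * h = c + k * h - 1 by ring]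
    linarith
  · refine Eventually.of_forall fun k => ?_
    have key := log_Gamma_add_sub_le (x := c + k * h) (by positivity) hh
    rw [show c + ((k + 1 : ℕ) : ℝ) * h = c + k * h + h by push_cast; ring,
      show c + h + k * h = c + k * h + h by ring]
    linarith

/-- The coefficients of the scalar Fox–Wright series. -/
noncomputable def foxWrightCoeff {m n : ℕ} (μ M : Fin m → ℝ) (ν N : Fin n → ℝ) (k : ℕ) : ℝ :=
  (∏ i, Real.Gamma (μ i + (k : ℝ) * M i)) /
    ((∏ j, Real.Gamma (ν j + (k : ℝ) * N j)) * (Nat.factorial k : ℝ))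

section FoxWright

variable {m n : ℕ} {μ M : Fin m → ℝ} {ν N : Fin n → ℝ}

lemma foxWrightCoeff_pos (hμ : ∀ i, 0 < μ i) (hν : ∀ j, 0 < ν j)
    (hM : ∀ i, 0 < M i) (hN : ∀ j, 0 < N j) (k : ℕ) : 0 < foxWrightCoeff μ M ν N k := by
  have hΓ : ∀ {c h : ℝ}, 0 < c → 0 < h → 0 < Real.Gamma (c + k * h) := fun hc hh =>
    Real.Gamma_pos_of_pos (by positivity)
  exact div_pos (Finset.prod_pos fun i _ => hΓ (hμ i) (hM i))
    (mul_pos (Finset.prod_pos fun j _ => hΓ (hν j) (hN j)) (by positivity))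

lemma log_foxWrightCoeff (hμ : ∀ i, 0 < μ i) (hν : ∀ j, 0 < ν j)
    (hM : ∀ i, 0 < M i) (hN : ∀ j, 0 < N j) (k : ℕ) :
    Real.log (foxWrightCoeff μ M ν N k) = ∑ i, Real.log (Real.Gamma (μ i + k * M i)) -
      (∑ j, Real.log (Real.Gamma (ν j + k * N j)) + Real.log (Nat.factorial k)) := by
  have hΓ : ∀ {c h : ℝ}, 0 < c → 0 < h → Real.Gamma (c + k * h) ≠ 0 := fun hc hh =>
    (Real.Gamma_pos_of_pos (by positivity)).ne'
  have hnum : ∏ i, Real.Gamma (μ i + k * M i) ≠ 0 :=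
    Finset.prod_ne_zero_iff.2 fun i _ => hΓ (hμ i) (hM i)
  have hden : ∏ j, Real.Gamma (ν j + k * N j) ≠ 0 :=
    Finset.prod_ne_zero_iff.2 fun j _ => hΓ (hν j) (hN j)
  have hfac : (Nat.factorial k : ℝ) ≠ 0 := by positivity
  rw [foxWrightCoeff, Real.log_div hnum (mul_ne_zero hden hfac), Real.log_mul hden hfac,
    Real.log_prod fun i _ => hΓ (hμ i) (hM i), Real.log_prod fun j _ => hΓ (hν j) (hN j)]

lemma tendsto_foxWrightCoeff_succ_div (hμ : ∀ i, 0 < μ i) (hν : ∀ j, 0 < ν j)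
    (hM : ∀ i, 0 < M i) (hN : ∀ j, 0 < N j) (hΥ : -1 < ∑ j, N j - ∑ i, M i) :
    Tendsto (fun k => foxWrightCoeff μ M ν N (k + 1) / foxWrightCoeff μ M ν N k)
      atTop (𝓝 0) := by
  have hpos := foxWrightCoeff_pos hμ hν hM hN
  have hnum := tendsto_finsetSum Finset.univ fun i _ =>
    tendsto_log_Gamma_increment (hμ i) (hM i)
  have hden := tendsto_finsetSum Finset.univ fun j _ =>
    tendsto_log_Gamma_increment (hν j) (hN j)
  have hfac := tendsto_log_add_mul_sub_log 1 one_pos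
  have hlog : Tendsto (fun k : ℕ => (∑ j, N j - ∑ i, M i + 1) * Real.log k) atTop atTop :=
    (Real.tendsto_log_atTop.comp tendsto_natCast_atTop_atTop).const_mul_atTop (by linarith)
  have hbot := ((hnum.sub hden).sub hfac).add_atBot (tendsto_neg_atTop_atBot.comp hlog)
  refine (Real.tendsto_exp_atBot.comp hbot).congr fun k => ?_
  rw [← Real.exp_log (div_pos (hpos (k + 1)) (hpos k)),
    Real.log_div (hpos _).ne' (hpos _).ne', log_foxWrightCoeff hμ hν hM hN,
    log_foxWrightCoeff hμ hν hM hN, Nat.factorial_succ, Nat.cast_mul,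
    Real.log_mul (by positivity) (by positivity)]
  simp only [Function.comp_apply, Finset.sum_sub_distrib, ← Finset.sum_mul]
  congr 1
  rw [show (1 : ℝ) + k * 1 = ((k + 1 : ℕ) : ℝ) by push_cast; ring]
  ring

lemma summable_foxWrightCoeff_mul_pow (hμ : ∀ i, 0 < μ i) (hν : ∀ j, 0 < ν j)
    (hM : ∀ i, 0 < M i) (hN : ∀ j, 0 < N j) (hΥ : -1 < ∑ j, N j - ∑ i, M i) (z : ℂ) :
    Summable fun k : ℕ => (foxWrightCoeff μ M ν N k : ℂ) * z ^ k := by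
  have hpos := foxWrightCoeff_pos hμ hν hM hN
  have hlim := (tendsto_foxWrightCoeff_succ_div hμ hν hM hN hΥ).mul_const ‖z‖
  rw [zero_mul] at hlim
  refine summable_of_ratio_norm_eventually_le (r := 1 / 2) (by norm_num) ?_
  filter_upwards [hlim.eventually (ge_mem_nhds (by norm_num : (0 : ℝ) < 1 / 2))] with k hk
  rw [div_mul_eq_mul_div, div_le_iff₀ (hpos k)] at hk
  simp only [norm_mul, norm_pow, Complex.norm_real, Real.norm_of_nonneg (hpos _).le]
  calc foxWrightCoeff μ M ν N (k + 1) * ‖z‖ ^ (k + 1)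
      = foxWrightCoeff μ M ν N (k + 1) * ‖z‖ * ‖z‖ ^ k := by ring
    _ ≤ 1 / 2 * foxWrightCoeff μ M ν N k * ‖z‖ ^ k := by gcongr
    _ = 1 / 2 * (foxWrightCoeff μ M ν N k * ‖z‖ ^ k) := by ring

end FoxWright

/-- Bicomplex Fox–Wright series in idempotent coordinates
(the product ring ℂ × ℂ, components indexed by `Fin 2`): if Υ₁ > −1 and
Υ₂ > −1, then for every Z = (z₁, z₂) both component series converge
absolutely (each component family is summable). -/
theorem bicomplexFoxWright_summable_of_upsilon_gt_neg_one
    (m n : ℕ) (μ M : Fin 2 → Fin m → ℝ) (ν N : Fin 2 → Fin n → ℝ)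
    (hμ : ∀ p i, 0 < μ p i) (hν : ∀ p j, 0 < ν p j)
    (hM : ∀ p i, 0 < M p i) (hN : ∀ p j, 0 < N p j)
    (a : Fin 2 → ℕ → ℝ)
    (ha : ∀ p (k : ℕ), a p k =
      (∏ i, Real.Gamma (μ p i + (k : ℝ) * M p i)) /
        ((∏ j, Real.Gamma (ν p j + (k : ℝ) * N p j)) * (Nat.factorial k : ℝ)))
    (hΥ : ∀ p, -1 < (∑ j, N p j) - (∑ i, M p i)) :
    ∀ z : Fin 2 → ℂ, ∀ p, Summable fun k : ℕ => (a p k : ℂ) * z p ^ k := by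
  intro z p
  simp only [ha p]
  exact summable_foxWrightCoeff_mul_pow (hμ p) (hν p) (hM p) (hN p) (hΥ p) (z p)
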